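/- Let (Z,A,S) be a normal bivariate Birkhoff interpolation scheme in which Z is (p,q)-rectangular. Let A' be obtained from A by removing one element lying on the OX axis, and let S' be obtained from S by removing the last (p+1) elements of S from each of the lines y=i for 0≤i≤q. Suppose S' is a lower set, and suppose both univariate schemes (Z_x, A_x, S_x) and (Z_x, A'_x, S'_x) are regular. Then (Z,A,S) is regular if and only if (Z,A',S') is regular. -/

import Mathlib

open Finset

/-- A finite subset of `ℤ≥0²` is a *lower set* if it is closed under
coordinatewise decrease. -/
def IsLower (S : Finset (ℕ × ℕ)) : Prop :=
  ∀ u v, (u, v) ∈ S → ∀ i j, i ≤ u → j ≤ v → (i, j) ∈ S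

/-- The value at `(x,y)` of `∂^{i+j}P/∂x^i∂y^j`, where `P` is the polynomial
with coefficients `a` supported on `S`. -/
noncomputable def derivAt (S : Finset (ℕ × ℕ)) (a : ℕ × ℕ → ℝ) (i j : ℕ) (x y : ℝ) : ℝ :=
  ∑ uv ∈ S, a uv * (uv.1.descFactorial i : ℝ) * (uv.2.descFactorial j : ℝ) *
      x ^ (uv.1 - i) * y ^ (uv.2 - j)

/-- The bivariate Birkhoff scheme `(Z,A,S)` is *regular*: every interpolation
problem has a unique solution in `P_S` (polynomials supported on `S`). -/
def Regular (Z : Finset (ℝ × ℝ)) (A S : Finset (ℕ × ℕ)) : Prop :=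
  ∀ c : ℕ × ℕ → ℝ × ℝ → ℝ, ∃! a : ℕ × ℕ → ℝ,
    (∀ uv, uv ∉ S → a uv = 0) ∧
    ∀ z ∈ Z, ∀ ij ∈ A, derivAt S a ij.1 ij.2 z.1 z.2 = c ij z

/-- The scheme `(Z,A,S)` is *solvable*: every interpolation problem has at
least one solution in `P_S`. -/
def Solvable (Z : Finset (ℝ × ℝ)) (A S : Finset (ℕ × ℕ)) : Prop :=
  ∀ c : ℕ × ℕ → ℝ × ℝ → ℝ, ∃ a : ℕ × ℕ → ℝ,
    (∀ uv, uv ∉ S → a uv = 0) ∧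
    ∀ z ∈ Z, ∀ ij ∈ A, derivAt S a ij.1 ij.2 z.1 z.2 = c ij z

/-- `Z ⊂ ℝ²` is a `(p,q)`-rectangular set of nodes. -/
def IsRect (p q : ℕ) (Z : Finset (ℝ × ℝ)) : Prop :=
  ∃ x : Fin (p + 1) → ℝ, ∃ y : Fin (q + 1) → ℝ,
    Function.Injective x ∧ Function.Injective y ∧
    Z = (Finset.univ : Finset (Fin (p + 1) × Fin (q + 1))).image (fun ij => (x ij.1, y ij.2))

/-- `B_x = {i : (i,0) ∈ B}`. -/
def setX (B : Finset (ℕ × ℕ)) : Finset ℕ := (B.filter fun ij => ij.2 = 0).image Prod.fst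

/-- `B_y = {j : (0,j) ∈ B}`. -/
def setY (B : Finset (ℕ × ℕ)) : Finset ℕ := (B.filter fun ij => ij.1 = 0).image Prod.snd

/-- `B_x[β] = {α : (α,β) ∈ B}`. -/
def sliceX (B : Finset (ℕ × ℕ)) (b : ℕ) : Finset ℕ := (B.filter fun ij => ij.2 = b).image Prod.fst

/-- `B_y[α] = {β : (α,β) ∈ B}`. -/
def sliceY (B : Finset (ℕ × ℕ)) (a : ℕ) : Finset ℕ := (B.filter fun ij => ij.1 = a).image Prod.snd

/-- Projection of the nodes on the OX axis. -/
noncomputable def nodesX (Z : Finset (ℝ × ℝ)) : Finset ℝ := Z.image Prod.fst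

/-- Projection of the nodes on the OY axis. -/
noncomputable def nodesY (Z : Finset (ℝ × ℝ)) : Finset ℝ := Z.image Prod.snd

/-- The rectangle `R(u,v) = {(i,j) : i ≤ u, j ≤ v}`. -/
def rect (u v : ℕ) : Finset (ℕ × ℕ) := Finset.range (u + 1) ×ˢ Finset.range (v + 1)

/-- The blow-up `R^{p,q} = {(α,β) : (⌊α/(p+1)⌋, ⌊β/(q+1)⌋) ∈ R}`. -/
def blowup (p q : ℕ) (R : Finset (ℕ × ℕ)) : Finset (ℕ × ℕ) :=
  (R ×ˢ (Finset.range (p + 1) ×ˢ Finset.range (q + 1))).image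
    (fun x => ((p + 1) * x.1.1 + x.2.1, (q + 1) * x.1.2 + x.2.2))

/-- `n_{p,q}(L)`: number of `(α,β) ∈ L` with `(p+1) ∣ α` and `(q+1) ∣ β`. -/
def npq (p q : ℕ) (L : Finset (ℕ × ℕ)) : ℕ :=
  (L.filter fun ab => (p + 1) ∣ ab.1 ∧ (q + 1) ∣ ab.2).card

/-- Value at `x` of the `i`-th derivative of the univariate polynomial with
coefficients `a` supported on `S`. -/
noncomputable def derivAt1 (S : Finset ℕ) (a : ℕ → ℝ) (i : ℕ) (x : ℝ) : ℝ :=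
  ∑ u ∈ S, a u * (u.descFactorial i : ℝ) * x ^ (u - i)

/-- Regularity of the univariate Birkhoff scheme `(W,A,S)`. -/
def Regular1 (W : Finset ℝ) (A S : Finset ℕ) : Prop :=
  ∀ c : ℕ → ℝ → ℝ, ∃! a : ℕ → ℝ,
    (∀ u, u ∉ S → a u = 0) ∧
    ∀ w ∈ W, ∀ i ∈ A, derivAt1 S a i w = c i w

/-- `(A,S)` is almost regular with respect to `(p,q)`-rectangular sets of nodes. -/
def AlmostRegular (p q : ℕ) (A S : Finset (ℕ × ℕ)) : Prop :=
  ∃ Z : Finset (ℝ × ℝ), IsRect p q Z ∧ Regular Z A S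


/-- The coefficient of `x ^ u` in the bivariate polynomial with coefficients `a` supported on `S`,
as a polynomial in `y`. -/
noncomputable def columnPoly (S : Finset (ℕ × ℕ)) (a : ℕ × ℕ → ℝ) (u : ℕ) : Polynomial ℝ :=
  ∑ uv ∈ S with uv.1 = u, Polynomial.monomial uv.2 (a uv)

/-- The interpolation problem with the derivative orders of `A` off the axis `OX`, for the
polynomials supported on `S` that vanish on the lines `y = t`, `t ∈ Y`, is uniquely solvable. -/
def RegularVanishing (Y : Finset ℝ) (Z : Finset (ℝ × ℝ)) (A S : Finset (ℕ × ℕ)) : Prop :=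
  ∀ c : ℕ × ℕ → ℝ × ℝ → ℝ, ∃! a : ℕ × ℕ → ℝ,
    (∀ uv, uv ∉ S → a uv = 0) ∧
    (∀ y ∈ Y, ∀ u, (columnPoly S a u).eval y = 0) ∧
    ∀ z ∈ Z, ∀ ij ∈ A, ij.2 ≠ 0 → derivAt S a ij.1 ij.2 z.1 z.2 = c ij z

theorem IsRect.exists_eq_product {p q : ℕ} {Z : Finset (ℝ × ℝ)} (hZ : IsRect p q Z) :
    ∃ X Y : Finset ℝ, X.card = p + 1 ∧ Y.card = q + 1 ∧ Z = X ×ˢ Y := by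
  obtain ⟨x, y, hx, hy, rfl⟩ := hZ
  refine ⟨univ.image x, univ.image y, ?_, ?_, ?_⟩
  · simp [card_image_of_injective _ hx]
  · simp [card_image_of_injective _ hy]
  · ext ⟨s, t⟩
    simp

theorem mem_setX {S : Finset (ℕ × ℕ)} {u : ℕ} : u ∈ setX S ↔ (u, 0) ∈ S := by
  simp [setX]

theorem IsLower.lt_card_row_iff {S : Finset (ℕ × ℕ)} (hS : IsLower S) (u v : ℕ) :
    u < #{cd ∈ S | cd.2 = v} ↔ (u, v) ∈ S := by
  constructor
  · intro h
    by_contra hu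
    have hsub : {cd ∈ S | cd.2 = v} ⊆ range u ×ˢ {v} := by
      rintro ⟨i, j⟩ hij
      simp only [mem_filter] at hij
      obtain ⟨hij, rfl⟩ := hij
      simp only [mem_product, mem_range, mem_singleton, and_true]
      by_contra! hui
      exact hu (hS i j hij u j hui le_rfl)
    have := card_le_card hsub
    simp at this
    omega
  · intro h
    have hsub : range (u + 1) ×ˢ {v} ⊆ {cd ∈ S | cd.2 = v} := by
      rintro ⟨i, j⟩ hij
      simp only [mem_product, mem_range, mem_singleton] at hij
      simp only [mem_filter]
      exact ⟨hS u v h i j (by omega) hij.2.le, hij.2⟩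
    have := card_le_card hsub
    simp at this
    omega

theorem coeff_columnPoly {S : Finset (ℕ × ℕ)} {a : ℕ × ℕ → ℝ} (ha : ∀ uv, uv ∉ S → a uv = 0)
    (u v : ℕ) : (columnPoly S a u).coeff v = a (u, v) := by
  rw [columnPoly, Polynomial.finsetSum_coeff]
  simp only [Polynomial.coeff_monomial]
  by_cases h : (u, v) ∈ S
  · rw [Finset.sum_eq_single (u, v)]
    · simp
    · rintro ⟨i, j⟩ hij hne
      simp only [mem_filter] at hij
      rw [if_neg]
      rintro rfl
      exact hne (by rw [← hij.2])
    · simp [h]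
  · rw [ha _ h]
    refine Finset.sum_eq_zero ?_
    rintro ⟨i, j⟩ hij
    simp only [mem_filter] at hij
    rw [if_neg]
    rintro rfl
    exact h (hij.2 ▸ hij.1)

theorem eval_columnPoly (S : Finset (ℕ × ℕ)) (a : ℕ × ℕ → ℝ) (u : ℕ) (y : ℝ) :
    (columnPoly S a u).eval y = ∑ uv ∈ S with uv.1 = u, a uv * y ^ uv.2 := by
  simp [columnPoly, Polynomial.eval_finsetSum]

theorem eval_columnPoly_of_notMem {S : Finset (ℕ × ℕ)} (hS : IsLower S) (a : ℕ × ℕ → ℝ) {u : ℕ}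
    (hu : u ∉ setX S) (y : ℝ) : (columnPoly S a u).eval y = 0 := by
  rw [eval_columnPoly]
  refine Finset.sum_eq_zero ?_
  rintro ⟨i, j⟩ hij
  simp only [mem_filter] at hij
  obtain ⟨hij, rfl⟩ := hij
  exact absurd (mem_setX.2 (hS i j hij i 0 le_rfl (Nat.zero_le _))) hu

theorem columnPoly_eq_zero {S : Finset (ℕ × ℕ)} {a : ℕ × ℕ → ℝ} (hS : IsLower S)
    (ha : ∀ uv, uv ∉ S → a uv = 0) {u : ℕ} {Y : Finset ℝ} (hu : (u, Y.card) ∉ S)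
    (hY : ∀ y ∈ Y, (columnPoly S a u).eval y = 0) : columnPoly S a u = 0 := by
  refine Polynomial.eq_zero_of_degree_lt_of_eval_finset_eq_zero Y ?_ hY
  rw [Polynomial.degree_lt_iff_coeff_zero]
  intro m hm
  rw [coeff_columnPoly ha]
  exact ha _ fun h => hu (hS u m h u _ le_rfl hm)

theorem derivAt_zero_right {S : Finset (ℕ × ℕ)} (hS : IsLower S) (a : ℕ × ℕ → ℝ) (i : ℕ)
    (x y : ℝ) :
    derivAt S a i 0 x y = derivAt1 (setX S) (fun u => (columnPoly S a u).eval y) i x := by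
  have hmaps : ∀ uv ∈ S, uv.1 ∈ setX S := fun uv huv =>
    mem_setX.2 (hS uv.1 uv.2 huv _ _ le_rfl (Nat.zero_le _))
  rw [derivAt, derivAt1, ← Finset.sum_fiberwise_of_maps_to hmaps]
  refine Finset.sum_congr rfl fun u _ => ?_
  rw [eval_columnPoly, Finset.sum_mul, Finset.sum_mul]
  refine Finset.sum_congr rfl fun uv huv => ?_
  rw [(mem_filter.1 huv).2]
  simp
  ring

theorem derivAt_add (S : Finset (ℕ × ℕ)) (a b : ℕ × ℕ → ℝ) (i j : ℕ) (x y : ℝ) :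
    derivAt S (a + b) i j x y = derivAt S a i j x y + derivAt S b i j x y := by
  simp only [derivAt, ← Finset.sum_add_distrib, Pi.add_apply]
  exact Finset.sum_congr rfl fun _ _ => by ring

theorem derivAt_sub (S : Finset (ℕ × ℕ)) (a b : ℕ × ℕ → ℝ) (i j : ℕ) (x y : ℝ) :
    derivAt S (a - b) i j x y = derivAt S a i j x y - derivAt S b i j x y := by
  simp only [derivAt, ← Finset.sum_sub_distrib, Pi.sub_apply]
  exact Finset.sum_congr rfl fun _ _ => by ring

theorem derivAt_congr_of_subset {S S' : Finset (ℕ × ℕ)} (h : S' ⊆ S) {a : ℕ × ℕ → ℝ}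
    (ha : ∀ uv, uv ∉ S' → a uv = 0) (i j : ℕ) (x y : ℝ) :
    derivAt S' a i j x y = derivAt S a i j x y :=
  Finset.sum_subset h fun uv _ huv => by simp [ha uv huv]

theorem columnPoly_congr_of_subset {S S' : Finset (ℕ × ℕ)} (h : S' ⊆ S) {a : ℕ × ℕ → ℝ}
    (ha : ∀ uv, uv ∉ S' → a uv = 0) (u : ℕ) : columnPoly S' a u = columnPoly S a u := by
  ext v
  rw [coeff_columnPoly ha, coeff_columnPoly fun uv huv => ha uv fun h' => huv (h h')]

theorem derivAt1_zero (S : Finset ℕ) (i : ℕ) (x : ℝ) : derivAt1 S 0 i x = 0 := by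
  simp [derivAt1]

theorem Regular1.ext {W : Finset ℝ} {A S : Finset ℕ} (h : Regular1 W A S) {f g : ℕ → ℝ}
    (hf : ∀ u, u ∉ S → f u = 0) (hg : ∀ u, u ∉ S → g u = 0)
    (hfg : ∀ w ∈ W, ∀ i ∈ A, derivAt1 S f i w = derivAt1 S g i w) : f = g :=
  (h fun i w => derivAt1 S g i w).unique ⟨hf, hfg⟩ ⟨hg, fun _ _ _ _ => rfl⟩

/-- Vanishing of the derivatives of orders `(i, 0) ∈ A` at the nodes amounts to vanishing on
the horizontal lines through the nodes. -/
theorem derivAt_axis_eq_zero_iff {X Y : Finset ℝ} {A S : Finset (ℕ × ℕ)} (hS : IsLower S)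
    (hx : Regular1 X (setX A) (setX S)) (a : ℕ × ℕ → ℝ) :
    (∀ z ∈ X ×ˢ Y, ∀ ij ∈ A, ij.2 = 0 → derivAt S a ij.1 ij.2 z.1 z.2 = 0) ↔
      ∀ y ∈ Y, ∀ u, (columnPoly S a u).eval y = 0 := by
  constructor
  · intro h y hy
    refine congrFun (hx.ext (g := 0) (fun u hu => eval_columnPoly_of_notMem hS a hu y)
      (fun _ _ => rfl) fun w hw i hi => ?_)
    rw [derivAt1_zero, ← derivAt_zero_right hS]
    exact h (w, y) (mk_mem_product hw hy) (i, 0) (mem_setX.1 hi) rfl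
  · rintro h ⟨x, y⟩ hz ⟨i, j⟩ _ rfl
    rw [derivAt_zero_right hS]
    simp only [h y (mem_product.1 hz).2]
    exact derivAt1_zero _ _ _

theorem Regular.mem_of_mem_setX {X Y : Finset ℝ} {q : ℕ} {A S : Finset (ℕ × ℕ)}
    (hY : Y.card = q + 1) (hS : IsLower S) (hx : Regular1 X (setX A) (setX S))
    (h : Regular (X ×ˢ Y) A S) {u : ℕ} (hu : (u, 0) ∈ S) : (u, q) ∈ S := by
  by_contra huq
  obtain ⟨t, ht⟩ : Y.Nonempty := card_pos.1 (by omega)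
  obtain ⟨a, ⟨ha, hder⟩, -⟩ := h fun ij z =>
    derivAt1 (setX S) (Pi.single u (if z.2 = t then 1 else 0)) ij.1 z.1
  have hcol : ∀ y ∈ Y, (columnPoly S a u).eval y = if y = t then 1 else 0 := by
    intro y hy
    have := hx.ext (f := fun u => (columnPoly S a u).eval y)
      (g := Pi.single u (if y = t then 1 else 0))
      (fun u hu => eval_columnPoly_of_notMem hS a hu y)
      (fun v hv => Pi.single_eq_of_ne (by rintro rfl; exact hv (mem_setX.2 hu)) _)
      fun w hw i hi => by
        rw [← derivAt_zero_right hS]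
        exact hder (w, y) (mk_mem_product hw hy) (i, 0) (mem_setX.1 hi)
    simpa using congrFun this u
  have hzero : columnPoly S a u = 0 := by
    refine columnPoly_eq_zero (Y := Y.erase t) hS ha ?_ fun y hy => ?_
    · rwa [card_erase_of_mem ht, hY]
    · rw [hcol y (mem_of_mem_erase hy), if_neg (ne_of_mem_erase hy)]
  simpa [hzero] using hcol t ht

theorem exists_eval_columnPoly_eq {Y : Finset ℝ} {q : ℕ} {S : Finset (ℕ × ℕ)}
    (hY : Y.card = q + 1) (hS : IsLower S) (hfull : ∀ u, (u, 0) ∈ S → (u, q) ∈ S)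
    (g : ℝ → ℕ → ℝ) (hg : ∀ y, ∀ u, u ∉ setX S → g y u = 0) :
    ∃ a : ℕ × ℕ → ℝ, (∀ uv, uv ∉ S → a uv = 0) ∧
      ∀ y ∈ Y, ∀ u, (columnPoly S a u).eval y = g y u := by
  set L : ℕ → Polynomial ℝ := fun u => Lagrange.interpolate Y id fun y => g y u with hL
  have hsupp : ∀ uv, uv ∉ S → (L uv.1).coeff uv.2 = 0 := by
    rintro ⟨u, v⟩ huv
    by_cases hu : u ∈ setX S
    · refine Polynomial.coeff_eq_zero_of_degree_lt ?_
      refine (Lagrange.degree_interpolate_lt _ (Set.injOn_id _)).trans_le ?_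
      rw [hY]
      refine Nat.cast_le.2 (Nat.succ_le_of_lt ?_)
      by_contra! hvq
      exact huv (hS u q (hfull u (mem_setX.1 hu)) u v le_rfl hvq)
    · have : (fun y => g y u) = 0 := funext fun y => hg y u hu
      simp only [hL, this, map_zero, Polynomial.coeff_zero]
  refine ⟨fun uv => (L uv.1).coeff uv.2, hsupp, fun y hy u => ?_⟩
  have : columnPoly S (fun uv => (L uv.1).coeff uv.2) u = L u := by
    ext v
    rw [coeff_columnPoly hsupp]
  rw [this]
  exact Lagrange.eval_interpolate_at_node (v := id) _ (Set.injOn_id _) hy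

theorem regular_iff_regularVanishing {X Y : Finset ℝ} {q : ℕ} {A S : Finset (ℕ × ℕ)}
    (hY : Y.card = q + 1) (hS : IsLower S) (hx : Regular1 X (setX A) (setX S)) :
    Regular (X ×ˢ Y) A S ↔
      (∀ u, (u, 0) ∈ S → (u, q) ∈ S) ∧ RegularVanishing Y (X ×ˢ Y) A S := by
  constructor
  · refine fun h => ⟨fun u hu => h.mem_of_mem_setX hY hS hx hu, fun c => ?_⟩
    refine (existsUnique_congr fun a => ?_).1 (h fun ij z => if ij.2 = 0 then 0 else c ij z)
    rw [← derivAt_axis_eq_zero_iff hS hx]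
    refine and_congr_right fun _ => ⟨fun h => ⟨?_, ?_⟩, fun h z hz ij hij => ?_⟩
    · intro z hz ij hij h0
      simpa [h0] using h z hz ij hij
    · intro z hz ij hij h0
      simpa [h0] using h z hz ij hij
    · split_ifs with h0
      · exact h.1 z hz ij hij h0
      · exact h.2 z hz ij hij h0
  · rintro ⟨hfull, h⟩ c
    have hex : ∀ y, ∃ f : ℕ → ℝ, (∀ u, u ∉ setX S → f u = 0) ∧
        ∀ w ∈ X, ∀ i ∈ setX A, derivAt1 (setX S) f i w = c (i, 0) (w, y) := fun y =>
      (hx fun i w => c (i, 0) (w, y)).exists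
    choose g hg hgder using hex
    obtain ⟨a, ha, hcol⟩ := exists_eval_columnPoly_eq hY hS hfull g hg
    obtain ⟨b, ⟨hb, hbcol, hbder⟩, -⟩ :=
      h fun ij z => c ij z - derivAt S a ij.1 ij.2 z.1 z.2
    refine ⟨a + b, ⟨fun uv huv => by simp [ha uv huv, hb uv huv], ?_⟩, ?_⟩
    · rintro ⟨x, y⟩ hz ⟨i, j⟩ hij
      rw [derivAt_add]
      obtain ⟨hxX, hyY⟩ := mem_product.1 hz
      rcases eq_or_ne j 0 with rfl | hj
      · have hb0 := (derivAt_axis_eq_zero_iff hS hx b).2 hbcol _ hz _ hij rfl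
        rw [hb0, add_zero, derivAt_zero_right hS]
        simp only [hcol y hyY]
        exact hgder y x hxX i (mem_setX.2 hij)
      · rw [hbder _ hz _ hij hj]
        ring
    · rintro b' ⟨hb', hb'der⟩
      have hdiff : b' - a = b := by
        refine (h fun ij z => c ij z - derivAt S a ij.1 ij.2 z.1 z.2).unique
          ⟨fun uv huv => by simp [ha uv huv, hb' uv huv], ?_, ?_⟩ ⟨hb, hbcol, hbder⟩
        · rw [← derivAt_axis_eq_zero_iff hS hx]
          rintro ⟨x, y⟩ hz ⟨i, j⟩ hij rfl
          obtain ⟨hxX, hyY⟩ := mem_product.1 hz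
          rw [derivAt_sub, hb'der _ hz _ hij, derivAt_zero_right hS]
          simp only [hcol y hyY]
          rw [hgder y x hxX i (mem_setX.2 hij), sub_self]
        · intro z hz ij hij _
          rw [derivAt_sub, hb'der z hz ij hij]
      rw [← hdiff]
      abel

theorem regularVanishing_congr {Y : Finset ℝ} {Z : Finset (ℝ × ℝ)} {A A' S S' : Finset (ℕ × ℕ)}
    (hA : ∀ ij : ℕ × ℕ, ij.2 ≠ 0 → (ij ∈ A ↔ ij ∈ A')) (hS : IsLower S) (hS' : IsLower S')
    (hsub : S' ⊆ S) (htop : ∀ u, (u, Y.card) ∈ S → (u, Y.card) ∈ S')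
    (hdiff : ∀ u v, (u, v) ∈ S → (u, v) ∉ S' → v < Y.card) :
    RegularVanishing Y Z A S ↔ RegularVanishing Y Z A' S' := by
  refine forall_congr' fun c => existsUnique_congr fun a => ?_
  have hder : (∀ z ∈ Z, ∀ ij ∈ A, ij.2 ≠ 0 → derivAt S a ij.1 ij.2 z.1 z.2 = c ij z) ↔
      ∀ z ∈ Z, ∀ ij ∈ A', ij.2 ≠ 0 → derivAt S a ij.1 ij.2 z.1 z.2 = c ij z :=
    ⟨fun h z hz ij hij h0 => h z hz ij ((hA ij h0).2 hij) h0,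
      fun h z hz ij hij h0 => h z hz ij ((hA ij h0).1 hij) h0⟩
  rw [hder]
  constructor
  · rintro ⟨ha, hcol, h⟩
    have ha' : ∀ uv, uv ∉ S' → a uv = 0 := by
      rintro ⟨u, v⟩ huv
      by_cases huvS : (u, v) ∈ S
      · have hv := hdiff u v huvS huv
        have hu : (u, Y.card) ∉ S := fun hmem =>
          huv (hS' u _ (htop u hmem) u v le_rfl hv.le)
        rw [← coeff_columnPoly ha, columnPoly_eq_zero hS ha hu fun y hy => hcol y hy u,
          Polynomial.coeff_zero]
      · exact ha _ huvS
    simp only [derivAt_congr_of_subset hsub ha', columnPoly_congr_of_subset hsub ha']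
    exact ⟨ha', hcol, h⟩
  · rintro ⟨ha', h⟩
    simp only [derivAt_congr_of_subset hsub ha', columnPoly_congr_of_subset hsub ha'] at h
    exact ⟨fun uv huv => ha' uv fun hmem => huv (hsub hmem), h⟩

/-- removing one element of `A` from the OX axis, and removing
the last `(p+1)` elements of `S` from each of the lines `y = i`, `0 ≤ i ≤ q`
(for `S` lower this means keeping `(α,i)` iff `α + (p+1)` is less than the
number of elements of `S` on the line `y = i`), preserves/reflects
regularity, provided both induced univariate schemes on OX are regular. -/
theorem remove_on_axis (p q a : ℕ) (Z : Finset (ℝ × ℝ)) (A S : Finset (ℕ × ℕ))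
    (hZ : IsRect p q Z) (hS : IsLower S) (hnorm : S.card = Z.card * A.card)
    (ha : (a, 0) ∈ A)
    (A' : Finset (ℕ × ℕ)) (hA' : A' = A.erase (a, 0))
    (S' : Finset (ℕ × ℕ))
    (hS'def : S' = S.filter fun ab =>
      q < ab.2 ∨ ab.1 + (p + 1) < (S.filter fun cd => cd.2 = ab.2).card)
    (hS' : IsLower S')
    (hx : Regular1 (nodesX Z) (setX A) (setX S))
    (hx' : Regular1 (nodesX Z) (setX A') (setX S')) :
    (Regular Z A S ↔ Regular Z A' S') := by
  obtain ⟨X, Y, hX, hY, rfl⟩ := hZ.exists_eq_product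
  have hnodes : nodesX (X ×ˢ Y) = X := by
    rw [nodesX, product_image_fst (card_pos.1 (by omega))]
  rw [hnodes] at hx hx'
  have hmem : ∀ u v, (u, v) ∈ S' ↔ (u, v) ∈ S ∧ (q < v ∨ (u + (p + 1), v) ∈ S) := by
    intro u v
    rw [hS'def, mem_filter, hS.lt_card_row_iff]
  rw [regular_iff_regularVanishing hY hS hx, regular_iff_regularVanishing hY hS' hx']
  refine and_congr ⟨fun h u hu => ?_, fun h u hu => ?_⟩ (regularVanishing_congr ?_ hS hS' ?_ ?_ ?_)
  · have hu0 : (u + (p + 1), 0) ∈ S := by simpa using ((hmem u 0).1 hu).2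
    have huq := h _ hu0
    exact (hmem u q).2 ⟨hS _ _ huq _ _ (by omega) le_rfl, Or.inr huq⟩
  · have shift : ∀ w, (w + (p + 1), 0) ∈ S → (w + (p + 1), q) ∈ S := by
      intro w hw
      have hw' : (w, 0) ∈ S' := (hmem w 0).2 ⟨hS _ _ hw _ _ (by omega) le_rfl, Or.inr hw⟩
      simpa using ((hmem w q).1 (h w hw')).2
    by_cases hup : p + 1 ≤ u
    · obtain ⟨w, rfl⟩ := Nat.exists_eq_add_of_le' hup
      exact shift w hu
    by_cases hp : (p + 1, 0) ∈ S
    · have hpq : (p + 1, q) ∈ S := by simpa using shift 0 (by simpa using hp)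
      exact hS _ _ hpq _ _ (by omega) le_rfl
    · have hempty : ∀ i j, (i, j) ∉ S' := by
        intro i j hij
        have h00 := ((hmem 0 0).1 (hS' i j hij 0 0 (Nat.zero_le _) (Nat.zero_le _))).2
        exact hp (by simpa using h00)
      have hsub : S ⊆ range (p + 1) ×ˢ range (q + 1) := by
        rintro ⟨i, j⟩ hij
        simp only [mem_product, mem_range]
        constructor
        · by_contra! hi
          exact hp (hS i j hij _ _ hi (Nat.zero_le _))
        · by_contra! hj
          exact hempty i j ((hmem i j).2 ⟨hij, Or.inl hj⟩)
      have hcard : (range (p + 1) ×ˢ range (q + 1)).card ≤ S.card := by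
        rw [hnorm, card_product, card_product, hX, hY, card_range, card_range]
        exact Nat.le_mul_of_pos_right _ (card_pos.2 ⟨_, ha⟩)
      rw [eq_of_subset_of_card_le hsub hcard]
      simp only [mem_product, mem_range]
      omega
  · rintro ⟨i, j⟩ hj
    have hne : (i, j) ≠ (a, 0) := fun h => hj (congrArg Prod.snd h)
    simp [hA', hne]
  · exact hS'def ▸ filter_subset _ _
  · intro u hu
    rw [hY] at hu ⊢
    exact (hmem _ _).2 ⟨hu, Or.inl (by omega)⟩
  · intro u v huv huv'
    rw [hY]
    by_contra! hv
    exact huv' ((hmem _ _).2 ⟨huv, Or.inl (by omega)⟩)
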